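/- Let K be a field and let n, k be integers with 1 ≤ k ≤ n. In the polynomial ring K[x_{ij} : 1 ≤ i ≤ n, 1 ≤ j ≤ k] in nk variables, let I be the ideal generated by the determinants of all k × k submatrices of the generic n × k matrix (x_{ij}) (i.e., for each choice of k row indices, the determinant of the corresponding k × k matrix of variables). Then the Krull dimension of the quotient ring K[x_{ij}]/I equals (k − 1)(n + 1); equivalently, the Zariski closed locus Z_k of k-tuples (v_1, ..., v_k) of K-linearly dependent vectors in an n-dimensional vector space has codimension (n + 1) − k in the nk-dimensional affine space of all k-tuples. -/

import Mathlib

open scoped Matrix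

/-- Going up: heights do not drop along a suitable lift of a prime. -/
theorem PrimeSpectrum.exists_comap_eq_and_le_height {A B : Type*} [CommRing A] [CommRing B]
    [Algebra A B] [Algebra.IsIntegral A B] (hAB : Function.Injective (algebraMap A B)) (n : ℕ)
    (p : PrimeSpectrum A) (hp : n ≤ Order.height p) :
    ∃ P : PrimeSpectrum B, P.comap (algebraMap A B) = p ∧ n ≤ Order.height P := by
  induction n generalizing p with
  | zero =>
    obtain ⟨Q, -, hQ, hQp⟩ := Ideal.exists_ideal_over_prime_of_isIntegral (S := B) p.asIdeal ⊥
      (by rw [← RingHom.ker_eq_comap_bot, (RingHom.injective_iff_ker_eq_bot _).mp hAB]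
          exact bot_le)
    exact ⟨⟨Q, hQ⟩, PrimeSpectrum.ext hQp, by simp⟩
  | succ n ih =>
    obtain ⟨l, hl, hlen⟩ := Order.exists_series_of_le_height p hp
    have hlast : l.eraseLast.last < p := by
      rw [← hl]
      exact l.eraseLast_last_rel_last (by omega)
    obtain ⟨Q, hQ, hnQ⟩ := ih l.eraseLast.last (by
      simpa [hlen] using Order.length_le_height_last (p := l.eraseLast))
    obtain ⟨P, hQP, hP, hPp⟩ := Ideal.exists_ideal_over_prime_of_isIntegral p.asIdeal Q.asIdeal
      (by rw [← PrimeSpectrum.comap_asIdeal, hQ]; exact hlast.le)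
    have hlt : Q < ⟨P, hP⟩ := by
      refine lt_of_le_of_ne hQP fun h ↦ hlast.ne ?_
      rw [← hQ, h]
      exact PrimeSpectrum.ext hPp
    refine ⟨⟨P, hP⟩, PrimeSpectrum.ext hPp, ?_⟩
    push_cast
    exact (add_le_add_left hnQ 1).trans (Order.height_add_one_le hlt)

theorem ringKrullDim_eq_of_isIntegral {A B : Type*} [CommRing A] [CommRing B]
    [Algebra A B] [Algebra.IsIntegral A B] (hAB : Function.Injective (algebraMap A B)) :
    ringKrullDim A = ringKrullDim B := by
  apply le_antisymm
  · refine iSup_le fun l ↦ ?_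
    obtain ⟨P, -, hP⟩ := PrimeSpectrum.exists_comap_eq_and_le_height (B := B) hAB l.length l.last
      Order.length_le_height_last
    exact (WithBot.coe_le_coe.mpr hP).trans (Order.height_le_krullDim P)
  · exact Order.krullDim_le_of_strictMono (PrimeSpectrum.comap (algebraMap A B))
      fun P Q h ↦ Ideal.IsIntegral.comap_lt_comap (R := A) h

/-- The Krull dimension of an affine domain is its transcendence degree. -/
theorem exists_ringKrullDim_eq_and_trdeg_eq (K A : Type*) [Field K] [CommRing A] [IsDomain A]
    [Algebra K A] [Algebra.FiniteType K A] :
    ∃ s : ℕ, ringKrullDim A = s ∧ Algebra.trdeg K A = s := by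
  obtain ⟨s, g, hg, hint⟩ := exists_integral_inj_algHom_of_fg K A
  refine ⟨s, ?_, ?_⟩
  · algebraize [g.toRingHom]
    have : Algebra.IsIntegral (MvPolynomial (Fin s) K) A := ⟨hint⟩
    rw [← ringKrullDim_eq_of_isIntegral (A := MvPolynomial (Fin s) K) (B := A) hg]
    simp
  · algebraize [g.toRingHom]
    have : Algebra.IsIntegral (MvPolynomial (Fin s) K) A := ⟨hint⟩
    have : FaithfulSMul (MvPolynomial (Fin s) K) A := (faithfulSMul_iff_algebraMap_injective _ _).mpr hg
    have h := lift_trdeg_add_eq K (MvPolynomial (Fin s) K) A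
    simpa [trdeg_eq_zero] using h.symm

/-- The dimension of `R ⧸ I` is controlled by the quotients by the primes containing `I`. -/
theorem ringKrullDim_quotient_le_of_forall_isPrime {R : Type*} [CommRing R] (I : Ideal R)
    (d : WithBot ℕ∞) (h : ∀ P : Ideal R, P.IsPrime → I ≤ P → ringKrullDim (R ⧸ P) ≤ d) :
    ringKrullDim (R ⧸ I) ≤ d := by
  rw [ringKrullDim_quotient, Order.krullDim]
  refine iSup_le fun l ↦ ?_
  refine le_trans ?_ (h l.head.1.asIdeal l.head.1.isPrime l.head.2)
  rw [ringKrullDim_quotient]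
  let l' : LTSeries (PrimeSpectrum.zeroLocus (R := R) (l.head.1.asIdeal : Set R)) :=
    { length := l.length
      toFun i := ⟨(l i).1, l.head_le i⟩
      step i := l.step i }
  exact Order.LTSeries.length_le_krullDim l'

theorem Matrix.exists_det_submatrix_ne_zero_of_linearIndependent_col {L : Type*} [Field L]
    {n k : ℕ} (M : Matrix (Fin n) (Fin k) L) (h : LinearIndependent L M.col) :
    ∃ r : Fin k → Fin n, StrictMono r ∧ (M.submatrix r id).det ≠ 0 := by
  obtain ⟨κ, a, ha, hspan, hli⟩ := exists_linearIndependent' L M.row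
  have : Finite κ := Finite.of_injective a ha
  have := Fintype.ofFinite κ
  have hcard : Fintype.card κ = k := by
    have h1 := finrank_span_eq_card hli
    rw [hspan, ← Matrix.rank_eq_finrank_span_row, ← Matrix.rank_transpose,
      LinearIndependent.rank_matrix (M := Mᵀ) h] at h1
    simpa using h1.symm
  classical
  let s : Finset (Fin n) := Finset.univ.image a
  have hs : s.card = k := by rw [Finset.card_image_of_injective _ ha, Finset.card_univ, hcard]
  refine ⟨s.orderEmbOfFin hs, (s.orderEmbOfFin hs).strictMono, ?_⟩
  rw [← isUnit_iff_ne_zero, ← Matrix.isUnit_iff_isUnit_det,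
    ← Matrix.linearIndependent_rows_iff_isUnit]
  have hmem (i : Fin k) : ∃ c, a c = s.orderEmbOfFin hs i := by
    obtain ⟨c, -, hc⟩ := Finset.mem_image.mp (s.orderEmbOfFin_mem hs i)
    exact ⟨c, hc⟩
  choose c hc using hmem
  have hcinj : Function.Injective c := fun i j hij ↦
    (s.orderEmbOfFin hs).injective (by rw [← hc, ← hc, hij])
  have hrow : (M.submatrix (s.orderEmbOfFin hs) id).row = (M.row ∘ a) ∘ c := by
    ext i j
    simp [hc]
  exact hrow ▸ hli.comp c hcinj

/-- If all maximal minors of the generic `n × k` matrix vanish in an affine domain, then the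
column relation bounds its transcendence degree. -/
theorem trdeg_quotient_le_of_det_mem {K : Type*} [Field K] {n k : ℕ}
    (P : Ideal (MvPolynomial (Fin n × Fin k) K)) [P.IsPrime]
    (hP : ∀ r : Fin k → Fin n, StrictMono r →
      Matrix.det (Matrix.of fun i j : Fin k => MvPolynomial.X (R := K) (r i, j)) ∈ P) :
    Algebra.trdeg K (MvPolynomial (Fin n × Fin k) K ⧸ P) ≤ ((k - 1) * (n + 1) : ℕ) := by
  let L := FractionRing (MvPolynomial (Fin n × Fin k) K ⧸ P)
  let ι : (MvPolynomial (Fin n × Fin k) K ⧸ P) →ₐ[K] L := IsScalarTower.toAlgHom K _ L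
  have hι : Function.Injective ι := IsFractionRing.injective _ L
  let φ : MvPolynomial (Fin n × Fin k) K →ₐ[K] L := ι.comp (Ideal.Quotient.mkₐ K P)
  let M : Matrix (Fin n) (Fin k) L := Matrix.of fun i j ↦ φ (.X (i, j))
  have hM : ¬ LinearIndependent L M.col := by
    intro h
    obtain ⟨r, hr, hdet⟩ := M.exists_det_submatrix_ne_zero_of_linearIndependent_col h
    have h0 : φ (Matrix.det (Matrix.of fun i j : Fin k => MvPolynomial.X (r i, j))) = 0 := by
      have : Ideal.Quotient.mkₐ K P
          (Matrix.det (Matrix.of fun i j : Fin k => MvPolynomial.X (r i, j))) = 0 :=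
        Ideal.Quotient.eq_zero_iff_mem.mpr (hP r hr)
      rw [AlgHom.comp_apply, this, map_zero]
    rw [AlgHom.map_det] at h0
    exact hdet h0
  obtain ⟨g, hg, j₀, hj₀⟩ := Fintype.not_linearIndependent_iff.mp hM
  let ψ : MvPolynomial (Option (Fin n) × {j : Fin k // j ≠ j₀}) K →ₐ[K] L :=
    MvPolynomial.aeval fun p ↦ p.1.elim (-(g p.2 / g j₀)) fun i ↦ M i p.2
  have hψ (o : Option (Fin n)) (j : {j : Fin k // j ≠ j₀}) : o.elim (-(g j.1 / g j₀)) (fun i ↦ M i j) ∈ ψ.range :=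
    ⟨.X (o, j), by simp [ψ]⟩
  have hφψ : φ.range ≤ ψ.range := by
    rw [← Algebra.map_top, ← MvPolynomial.adjoin_range_X, AlgHom.map_adjoin, Algebra.adjoin_le_iff]
    rintro _ ⟨_, ⟨⟨i, j⟩, rfl⟩, rfl⟩
    by_cases hj : j = j₀
    · subst hj
      have hi : ∑ l, g l * M i l = 0 := by simpa using congrFun hg i
      have hsum : M i j = ∑ l : {l : Fin k // l ≠ j}, -(g l / g j) * M i l := by
        rw [Fintype.sum_eq_add_sum_subtype_ne _ j] at hi
        have : M i j = -(∑ l : {l : Fin k // l ≠ j}, g l * M i l) / g j := by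
          rw [eq_div_iff hj₀]
          linear_combination hi
        rw [this, ← Finset.sum_neg_distrib, Finset.sum_div]
        exact Finset.sum_congr rfl fun _ _ ↦ by ring
      change M i j ∈ ψ.range
      rw [hsum]
      exact sum_mem fun l _ ↦ mul_mem (hψ none l) (hψ (some i) l)
    · exact hψ (some i) ⟨j, hj⟩
  have hmem (a) : ι a ∈ ψ.range := by
    obtain ⟨a, rfl⟩ := Ideal.Quotient.mkₐ_surjective K P a
    exact hφψ ⟨a, rfl⟩
  calc
    _ ≤ Algebra.trdeg K ψ.range := trdeg_le_of_injective (ι.codRestrict ψ.range hmem)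
      ((AlgHom.injective_codRestrict _ _ _).mpr hι)
    _ ≤ Algebra.trdeg K (MvPolynomial (Option (Fin n) × {j : Fin k // j ≠ j₀}) K) :=
      trdeg_le_of_surjective ψ.rangeRestrict ψ.rangeRestrict_surjective
    _ = _ := by simp [mul_comm]

section DependentTuples

variable (K : Type*) [Field K] (n m : ℕ)

/-- The comorphism of the parametrization `(y, c) ↦ (y₁, …, yₘ, ∑ cⱼ yⱼ)` of linearly
dependent tuples. -/
noncomputable def dependentTuplesHom : MvPolynomial (Fin n × Fin (m + 1)) K →ₐ[K]
    MvPolynomial (Option (Fin n) × Fin m) K :=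
  MvPolynomial.aeval fun p ↦ Fin.lastCases (motive := fun _ ↦ MvPolynomial _ K)
    (∑ j, .X (some p.1, j) * .X (none, j)) (fun j ↦ .X (some p.1, j)) p.2

@[simp]
theorem dependentTuplesHom_X_castSucc (i : Fin n) (j : Fin m) :
    dependentTuplesHom K n m (.X (i, j.castSucc)) = .X (some i, j) := by
  simp [dependentTuplesHom]

@[simp]
theorem dependentTuplesHom_X_last (i : Fin n) :
    dependentTuplesHom K n m (.X (i, Fin.last m)) = ∑ j, .X (some i, j) * .X (none, j) := by
  simp [dependentTuplesHom]

theorem dependentTuplesHom_det (r : Fin (m + 1) → Fin n) :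
    dependentTuplesHom K n m
      (Matrix.det (Matrix.of fun i j : Fin (m + 1) => MvPolynomial.X (r i, j))) = 0 := by
  rw [AlgHom.map_det, ← Matrix.exists_mulVec_eq_zero_iff]
  refine ⟨Fin.snoc (α := fun _ ↦ MvPolynomial (Option (Fin n) × Fin m) K)
    (fun j ↦ .X (none, j)) (-1), fun h ↦ ?_, ?_⟩
  · simpa using congrFun h (Fin.last m)
  · ext1 i
    simp [Matrix.mulVec, dotProduct, Fin.sum_univ_castSucc]

theorem isAlgebraic_range_dependentTuplesHom (hmn : m ≤ n) :
    Algebra.IsAlgebraic (dependentTuplesHom K n m).range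
      (MvPolynomial (Option (Fin n) × Fin m) K) := by
  set A := (dependentTuplesHom K n m).range
  have hy (i j) : .X (some i, j) ∈ A := ⟨_, dependentTuplesHom_X_castSucc K n m i j⟩
  let B : Matrix (Fin m) (Fin m) A := Matrix.of fun i j ↦ ⟨_, hy (Fin.castLE hmn i) j⟩
  let b : Fin m → A := fun i ↦ ⟨_, ⟨_, dependentTuplesHom_X_last K n m (Fin.castLE hmn i)⟩⟩
  let c : Fin m → MvPolynomial (Option (Fin n) × Fin m) K := fun j ↦ .X (none, j)
  have hB : B.det ≠ 0 := by
    intro h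
    let e : MvPolynomial (Option (Fin n) × Fin m) K →ₐ[K] K :=
      MvPolynomial.aeval fun p ↦ p.1.elim 0 fun i ↦ if (i : ℕ) = p.2 then 1 else 0
    have h1 := congrArg (e.comp A.val) h
    rw [AlgHom.map_det, map_zero] at h1
    have : (e.comp A.val).mapMatrix B = 1 := by
      ext i j
      simp [B, e, Matrix.one_apply, Fin.ext_iff]
    simp [this] at h1
  have hBc : (A.val.mapMatrix B) *ᵥ c = fun i ↦ (b i : MvPolynomial _ K) := by
    ext1 i
    simp [B, b, c, Matrix.mulVec, dotProduct]
  have hc (j) : IsAlgebraic A (c j) := by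
    have h : (B.det : MvPolynomial _ K) * c j = (((B.adjugate *ᵥ b) j : A) : MvPolynomial _ K) := by
      calc
        _ = (((A.val.mapMatrix B).adjugate * A.val.mapMatrix B) *ᵥ c) j := by
          rw [Matrix.adjugate_mul, Matrix.smul_mulVec, Matrix.one_mulVec, ← AlgHom.map_det]
          rfl
        _ = _ := by
          rw [← Matrix.mulVec_mulVec, hBc, ← AlgHom.map_adjugate]
          simp [Matrix.mulVec, dotProduct]
    refine ⟨.C B.det * .X - .C ((B.adjugate *ᵥ b) j), fun h0 ↦ hB ?_, ?_⟩
    · simpa using congrArg (Polynomial.coeff · 1) h0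
    · simp [h]
  refine ⟨fun t ↦ ?_⟩
  induction t using MvPolynomial.induction_on with
  | C a => exact isAlgebraic_algebraMap (algebraMap K A a)
  | add p q hp hq => exact hp.add hq
  | mul_X p x hp =>
    refine hp.mul ?_
    obtain ⟨_ | i, j⟩ := x
    · exact hc j
    · exact isAlgebraic_algebraMap (⟨_, hy i j⟩ : A)

theorem trdeg_range_dependentTuplesHom (hmn : m ≤ n) :
    Algebra.trdeg K (dependentTuplesHom K n m).range = (m * (n + 1) : ℕ) := by
  have := isAlgebraic_range_dependentTuplesHom K n m hmn
  have h := trdeg_add_eq K (dependentTuplesHom K n m).range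
    (A := MvPolynomial (Option (Fin n) × Fin m) K)
  rw [trdeg_eq_zero (R := (dependentTuplesHom K n m).range), add_zero] at h
  simp [h, mul_comm]

theorem ringKrullDim_range_dependentTuplesHom (hmn : m ≤ n) :
    ringKrullDim (dependentTuplesHom K n m).range = (m * (n + 1) : ℕ) := by
  have : Algebra.FiniteType K (dependentTuplesHom K n m).range :=
    .of_surjective (dependentTuplesHom K n m).rangeRestrict
      (dependentTuplesHom K n m).rangeRestrict_surjective
  obtain ⟨s, hdim, htr⟩ := exists_ringKrullDim_eq_and_trdeg_eq K (dependentTuplesHom K n m).range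
  rw [trdeg_range_dependentTuplesHom K n m hmn, Nat.cast_inj] at htr
  rw [hdim, htr]

end DependentTuples


/-- Let `K` be a field and `1 ≤ k ≤ n`.  In the polynomial ring `K[x_{ij}]` in `n·k`
variables, let `I` be the ideal generated by the determinants of all `k × k` submatrices
of the generic `n × k` matrix `(x_{ij})` (one for each strictly increasing choice of `k`
row indices).  Then the Krull dimension of `K[x_{ij}] ⧸ I` equals `(k - 1)(n + 1)`. -/
theorem krullDim_quotient_maximal_minors (K : Type*) [Field K] (n k : ℕ)
    (hk : 1 ≤ k) (hkn : k ≤ n) :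
    ringKrullDim (MvPolynomial (Fin n × Fin k) K ⧸
      Ideal.span { d : MvPolynomial (Fin n × Fin k) K |
        ∃ r : Fin k → Fin n, StrictMono r ∧
          d = Matrix.det (Matrix.of fun i j : Fin k => MvPolynomial.X (r i, j)) }) =
    (((k - 1) * (n + 1) : ℕ) : WithBot (WithTop ℕ)) := by
  obtain ⟨m, rfl⟩ := Nat.exists_eq_add_of_le' hk
  change _ = (((m + 1 - 1) * (n + 1) : ℕ) : WithBot ℕ∞)
  apply le_antisymm
  · refine ringKrullDim_quotient_le_of_forall_isPrime _ _ fun P hP hIP ↦ ?_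
    obtain ⟨s, hdim, htr⟩ := exists_ringKrullDim_eq_and_trdeg_eq K
      (MvPolynomial (Fin n × Fin (m + 1)) K ⧸ P)
    have h := trdeg_quotient_le_of_det_mem P fun r hr ↦ hIP (Ideal.subset_span ⟨r, hr, rfl⟩)
    rw [htr, Nat.cast_le] at h
    rw [hdim]
    exact_mod_cast h
  · rw [Nat.add_sub_cancel, ← ringKrullDim_range_dependentTuplesHom K n m (by omega)]
    let φ := (dependentTuplesHom K n m).rangeRestrict
    have hφ : ∀ a ∈ Ideal.span { d : MvPolynomial (Fin n × Fin (m + 1)) K |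
        ∃ r : Fin (m + 1) → Fin n, StrictMono r ∧
          d = Matrix.det (Matrix.of fun i j : Fin (m + 1) => MvPolynomial.X (r i, j)) },
        φ a = 0 := by
      refine fun a ha ↦ (Ideal.span_le (I := RingHom.ker φ)).mpr ?_ ha
      rintro _ ⟨r, -, rfl⟩
      exact Subtype.ext (dependentTuplesHom_det K n m r)
    exact ringKrullDim_le_of_surjective (Ideal.Quotient.lift _ φ.toRingHom hφ)
      (Ideal.Quotient.lift_surjective_of_surjective _ hφ
        (dependentTuplesHom K n m).rangeRestrict_surjective)
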